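/- Let (Z,ρ) be a K-quasi-metric space and let a,b,c,d be four pairwise distinct points of Z. Then 1/θ_K(1/r(a,b,c,d)) ≤ ⟨a,b,c,d⟩ ≤ θ_K(r(a,b,c,d)), where θ_K(t) = K²·max(t, √t). -/

import Mathlib

open Filter Topology

universe u v

/-- `ρ` is a `K`-quasi-metric on `Z`: nonnegative, vanishing exactly on the diagonal,
symmetric, and satisfying `ρ(x,z) ≤ K·max(ρ(x,y), ρ(y,z))`. -/
def IsQuasiMetric {Z : Type*} (K : ℝ) (ρ : Z → Z → ℝ) : Prop :=
  (∀ x y : Z, 0 ≤ ρ x y) ∧ (∀ x y : Z, ρ x y = 0 ↔ x = y) ∧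
    (∀ x y : Z, ρ x y = ρ y x) ∧ (∀ x y z : Z, ρ x z ≤ K * max (ρ x y) (ρ y z))

/-- `(Z,ρ)` is `μ`-uniformly perfect. -/
def UniformlyPerfectWith {Z : Type*} (ρ : Z → Z → ℝ) (μ : ℝ) : Prop :=
  ∀ x : Z, ∀ r : ℝ, 0 < r → (∃ z : Z, r ≤ ρ x z) →
    ∃ y : Z, μ * r ≤ ρ x y ∧ ρ x y < r

/-- `(Z,ρ)` is `(l₁,l₂)`-homogeneously dense. -/
def HomogeneouslyDense {Z : Type*} (ρ : Z → Z → ℝ) (l₁ l₂ : ℝ) : Prop :=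
  ∀ a b : Z, a ≠ b → ∃ x : Z, l₁ * ρ a b ≤ ρ a x ∧ ρ a x ≤ l₂ * ρ a b

/-- The cross ratio `r(a,b,c,d) = ρ(a,c)ρ(b,d)/(ρ(a,b)ρ(c,d))`. -/
noncomputable def crossRatio {Z : Type*} (ρ : Z → Z → ℝ) (a b c d : Z) : ℝ :=
  ρ a c * ρ b d / (ρ a b * ρ c d)

/-- `x : ℤ → Z` is a `σ`-chain joining `a` and `b`. -/
def IsSigmaChain {Z : Type*} (ρ : Z → Z → ℝ) (σ : ℝ) (a b : Z) (x : ℤ → Z) : Prop :=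
  (∀ i : ℤ, a ≠ x i ∧ x i ≠ b) ∧
    Filter.Tendsto (fun i : ℤ => ρ (x i) a) Filter.atBot (nhds 0) ∧
    Filter.Tendsto (fun i : ℤ => ρ (x i) b) Filter.atTop (nhds 0) ∧
    ∀ i : ℤ, |Real.log (crossRatio ρ a (x i) (x (i + 1)) b)| ≤ Real.log σ

/-- `(Z,ρ)` is `σ`-dense: any pair of distinct points is joined by a `σ`-chain. -/
def SigmaDense {Z : Type*} (ρ : Z → Z → ℝ) (σ : ℝ) : Prop :=
  ∀ a b : Z, a ≠ b → ∃ x : ℤ → Z, IsSigmaChain ρ σ a b x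

/-- `η` is an increasing self-homeomorphism of `[0,∞)`. -/
def ControlFun (η : ℝ → ℝ) : Prop :=
  η 0 = 0 ∧ StrictMonoOn η (Set.Ici 0) ∧ ContinuousOn η (Set.Ici 0) ∧
    ∀ s : ℝ, 0 ≤ s → ∃ t : ℝ, 0 ≤ t ∧ η t = s

/-- `f` is `η`-quasisymmetric. -/
def QuasiSymmetric {Z₁ Z₂ : Type*} (ρ₁ : Z₁ → Z₁ → ℝ) (ρ₂ : Z₂ → Z₂ → ℝ)
    (f : Z₁ → Z₂) (η : ℝ → ℝ) : Prop :=
  ∀ x a b : Z₁, x ≠ b → ∀ t : ℝ, 0 ≤ t → ρ₁ x a ≤ t * ρ₁ x b →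
    ρ₂ (f x) (f a) ≤ η t * ρ₂ (f x) (f b)

/-- `f` is `θ`-quasimöbius. -/
def QuasiMobius {Z₁ Z₂ : Type*} (ρ₁ : Z₁ → Z₁ → ℝ) (ρ₂ : Z₂ → Z₂ → ℝ)
    (f : Z₁ → Z₂) (θ : ℝ → ℝ) : Prop :=
  ∀ a b c d : Z₁, a ≠ b → a ≠ c → a ≠ d → b ≠ c → b ≠ d → c ≠ d →
    crossRatio ρ₂ (f a) (f b) (f c) (f d) ≤ θ (crossRatio ρ₁ a b c d)

/-- `(Z,ρ)` has no isolated points. -/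
def NoIsolatedPoints {Z : Type*} (ρ : Z → Z → ℝ) : Prop :=
  ∀ x : Z, ∀ r : ℝ, 0 < r → ∃ y : Z, y ≠ x ∧ ρ x y < r
/-- `θ_K(t) = K²·max(t, √t)`. -/
noncomputable def thetaK (K t : ℝ) : ℝ := K ^ 2 * max t (Real.sqrt t)

/-- The Bonk–Kleiner quantity `⟨a,b,c,d⟩ = min(ρ(a,c), ρ(b,d)) / min(ρ(a,b), ρ(c,d))`. -/
noncomputable def bkRatio {Z : Type*} (ρ : Z → Z → ℝ) (a b c d : Z) : ℝ :=
  min (ρ a c) (ρ b d) / min (ρ a b) (ρ c d)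

lemma IsQuasiMetric.le_sq_mul_max {Z : Type*} {K : ℝ} {ρ : Z → Z → ℝ}
    (hρ : IsQuasiMetric K ρ) (hK : 1 ≤ K) (w x y z : Z) :
    ρ w z ≤ K ^ 2 * max (ρ w x) (max (ρ x y) (ρ y z)) := by
  obtain ⟨hnn, -, -, htri⟩ := hρ
  have hK0 : 0 ≤ K := by linarith
  calc ρ w z ≤ K * max (ρ w x) (ρ x z) := htri w x z
    _ ≤ K * max (K * ρ w x) (K * max (ρ x y) (ρ y z)) := by
        gcongr
        · exact le_mul_of_one_le_left (hnn w x) hK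
        · exact htri x y z
    _ = K ^ 2 * max (ρ w x) (max (ρ x y) (ρ y z)) := by
        rw [← mul_max_of_nonneg _ _ hK0]
        ring

lemma div_le_thetaK {K p P q Q : ℝ} (hK : 1 ≤ K) (hp : 0 < p) (hq : 0 < q) (hQ : 0 < Q)
    (hpP : p ≤ P) (h : Q ≤ K ^ 2 * max P q) :
    p / q ≤ thetaK K (p * P / (q * Q)) := by
  have hP : 0 < P := hp.trans_le hpP
  have hK0 : 0 < K := by linarith
  rcases max_cases P q with ⟨hm, -⟩ | ⟨hm, -⟩ <;> rw [hm] at h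
  · calc p / q ≤ K ^ 2 * (p * P / (q * Q)) := by
          rw [mul_div_assoc', div_le_div_iff₀ hq (by positivity)]
          nlinarith [mul_le_mul_of_nonneg_left h (mul_pos hp hq).le]
      _ ≤ thetaK K (p * P / (q * Q)) := by
          unfold thetaK
          gcongr
          exact le_max_left _ _
  · have hsqrt : p / (K * q) ≤ √(p * P / (q * Q)) := by
      apply Real.le_sqrt_of_sq_le
      rw [div_pow, div_le_div_iff₀ (by positivity) (by positivity)]
      calc p ^ 2 * (q * Q) ≤ (p * P) * (q * (K ^ 2 * q)) := by
            rw [sq]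
            gcongr
        _ = p * P * (K * q) ^ 2 := by ring
    calc p / q = K * (p / (K * q)) := by field_simp
      _ ≤ K ^ 2 * √(p * P / (q * Q)) := by
          gcongr
          nlinarith
      _ ≤ thetaK K (p * P / (q * Q)) := by
          unfold thetaK
          gcongr
          exact le_max_right _ _

lemma IsQuasiMetric.pos {Z : Type*} {K : ℝ} {ρ : Z → Z → ℝ} (hρ : IsQuasiMetric K ρ)
    {x y : Z} (h : x ≠ y) : 0 < ρ x y :=
  (hρ.1 x y).lt_of_ne' (mt (hρ.2.1 x y).1 h)

lemma IsQuasiMetric.bkRatio_le_thetaK {Z : Type*} {K : ℝ} {ρ : Z → Z → ℝ}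
    (hρ : IsQuasiMetric K ρ) (hK : 1 ≤ K) {a b c d : Z}
    (hab : a ≠ b) (hac : a ≠ c) (hbd : b ≠ d) (hcd : c ≠ d) :
    bkRatio ρ a b c d ≤ thetaK K (crossRatio ρ a b c d) := by
  have hsymm := hρ.2.2.1
  have hab' := hρ.pos hab
  have hac' := hρ.pos hac
  have hbd' := hρ.pos hbd
  have hcd' := hρ.pos hcd
  unfold bkRatio crossRatio
  rw [← min_mul_max (ρ a c) (ρ b d), ← min_mul_max (ρ a b) (ρ c d)]
  refine div_le_thetaK hK (lt_min hac' hbd') (lt_min hab' hcd') (lt_max_of_lt_left hab')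
    min_le_max ?_
  rcases le_total (ρ a b) (ρ c d) with h | h
  · rw [max_eq_right h, min_eq_left h]
    have := hρ.le_sq_mul_max hK c a b d
    rwa [hsymm c a, max_comm (ρ a b), ← max_assoc] at this
  · rw [max_eq_left h, min_eq_right h]
    have := hρ.le_sq_mul_max hK a c d b
    rwa [hsymm d b, max_comm (ρ c d), ← max_assoc] at this

/-- `1/θ_K(1/r(a,b,c,d)) ≤ ⟨a,b,c,d⟩ ≤ θ_K(r(a,b,c,d))`. -/
theorem stmt11 {Z : Type u} (K : ℝ) (hK : 1 ≤ K) (ρ : Z → Z → ℝ)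
    (hρ : IsQuasiMetric K ρ) (a b c d : Z)
    (hab : a ≠ b) (hac : a ≠ c) (had : a ≠ d) (hbc : b ≠ c) (hbd : b ≠ d) (hcd : c ≠ d) :
    1 / thetaK K (1 / crossRatio ρ a b c d) ≤ bkRatio ρ a b c d ∧
      bkRatio ρ a b c d ≤ thetaK K (crossRatio ρ a b c d) := by
  refine ⟨?_, hρ.bkRatio_le_thetaK hK hab hac hbd hcd⟩
  have h := hρ.bkRatio_le_thetaK hK hac hab hcd hbd
  have hpos : 0 < bkRatio ρ a c b d :=
    div_pos (lt_min (hρ.pos hab) (hρ.pos hcd)) (lt_min (hρ.pos hac) (hρ.pos hbd))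
  have hr : 1 / crossRatio ρ a b c d = crossRatio ρ a c b d := one_div_div _ _
  have hbk : bkRatio ρ a b c d = 1 / bkRatio ρ a c b d := (one_div_div _ _).symm
  rw [hr, hbk]
  exact one_div_le_one_div_of_le hpos h
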